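/- arXiv:1010.5184 — 2 statements merged into one kernel-verified Lean document; each statement's English description precedes it below -/
import Mathlib

section
/- Let d be a positive integer. Every f ∈ S̃_d is smooth at every point y ≠ 0. -/
open MeasureTheory Set

/-- Membership in the space `I_d`: `φ` is smooth on `ℝ` and the function
`x ↦ x^{-d-1} φ(-1/x)` (defined for `x ≠ 0`) extends to a smooth function on `ℝ`. -/
def MemI (d : ℕ) (φ : ℝ → ℂ) : Prop :=
  ContDiff ℝ (⊤ : ℕ∞) φ ∧
    ∃ ψ : ℝ → ℂ, ContDiff ℝ (⊤ : ℕ∞) ψ ∧ ∀ x : ℝ, x ≠ 0 → ψ x = ((x : ℂ) ^ (d + 1))⁻¹ * φ (-1 / x)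

/-- The normalized Fourier transform `φ̂(y) = (2π)^{-1/2} ∫_ℝ φ(x) e^{-ixy} dx`. -/
noncomputable def fourierHat (φ : ℝ → ℂ) (y : ℝ) : ℂ :=
  (((2 * Real.pi) ^ (-(1 : ℝ) / 2) : ℝ) : ℂ) * ∫ x : ℝ, φ x * Complex.exp (-(Complex.I * x * y))

/-- The operator `M_d(φ)(y) = |y|^{(1-d)/2} φ̂(y)`. -/
noncomputable def Md (d : ℕ) (φ : ℝ → ℂ) (y : ℝ) : ℂ :=
  ((|y| ^ ((1 - (d : ℝ)) / 2) : ℝ) : ℂ) * fourierHat φ y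

/-- Membership in `S̃_d = M_d(I_d)`, viewed as functions on `ℝ ∖ {0}`:
`f` agrees with `M_d(φ)` away from `0` for some `φ ∈ I_d`. -/
def MemStilde (d : ℕ) (f : ℝ → ℂ) : Prop :=
  ∃ φ : ℝ → ℂ, MemI d φ ∧ ∀ y : ℝ, y ≠ 0 → f y = Md d φ y

/-- `φ` has the form `u ↦ u^{-m} χ(-1/u)` away from `0`, with `χ` smooth on `ℝ`. -/
def SmoothDecay (m : ℕ) (φ : ℝ → ℂ) : Prop :=
  ContDiff ℝ (⊤ : ℕ∞) φ ∧
    ∃ χ : ℝ → ℂ, ContDiff ℝ (⊤ : ℕ∞) χ ∧ ∀ u : ℝ, u ≠ 0 → φ u = ((u : ℂ) ^ m)⁻¹ * χ (-1 / u)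

theorem MemI.smoothDecay {d : ℕ} {φ : ℝ → ℂ} (h : MemI d φ) : SmoothDecay (d + 1) φ := by
  obtain ⟨hφ, ψ, hψ, hψφ⟩ := h
  refine ⟨hφ, fun v => (-1) ^ (d + 1) * ψ v, contDiff_const.mul hψ, fun u hu => ?_⟩
  have hu' : (u : ℂ) ≠ 0 := by exact_mod_cast hu
  have h1 : -1 / (-1 / u) = u := by field_simp
  beta_reduce
  rw [hψφ (-1 / u) (by simp [hu]), h1]
  have h2 : ((-1 / u : ℝ) : ℂ) ^ (d + 1) = (-1) ^ (d + 1) * ((u : ℂ) ^ (d + 1))⁻¹ := by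
    push_cast
    rw [div_pow, div_eq_mul_inv]
  rw [h2]
  have h3 : (u : ℂ) ^ (d + 1) ≠ 0 := pow_ne_zero _ hu'
  have h4 : (-1 : ℂ) ^ (d + 1) ≠ 0 := pow_ne_zero _ (by norm_num)
  field_simp

theorem SmoothDecay.deriv {m : ℕ} {φ : ℝ → ℂ} (h : SmoothDecay m φ) :
    SmoothDecay (m + 1) (deriv φ) := by
  obtain ⟨hφ, χ, hχ, hχφ⟩ := h
  have hχ' : ContDiff ℝ (⊤ : ℕ∞) (_root_.deriv χ) := (contDiff_infty_iff_deriv.1 hχ).2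
  refine ⟨(contDiff_infty_iff_deriv.1 hφ).2,
    fun v => -(m : ℂ) * χ v - (v : ℂ) * _root_.deriv χ v, ?_, fun u hu => ?_⟩
  · exact (contDiff_const.mul hχ).sub (Complex.ofRealCLM.contDiff.mul hχ')
  · have hu' : (u : ℂ) ≠ 0 := by exact_mod_cast hu
    have hinner : HasDerivAt (fun u : ℝ => -1 / u) (1 / u ^ 2) u := by
      simpa [div_eq_mul_inv] using (hasDerivAt_inv hu).const_mul (-1)
    have hχd : HasDerivAt χ (_root_.deriv χ (-1 / u)) (-1 / u) :=
      ((contDiff_infty_iff_deriv.1 hχ).1 _).hasDerivAt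
    have hcomp := hχd.scomp u hinner
    have hpow : HasDerivAt (fun u : ℝ => ((u : ℂ) ^ m)⁻¹)
        (-((m : ℂ) * (u : ℂ) ^ (m - 1)) / ((u : ℂ) ^ m) ^ 2) u :=
      ((hasDerivAt_pow m (u : ℂ)).comp_ofReal).fun_inv (pow_ne_zero _ hu')
    have hprod := hpow.mul hcomp
    have heq : φ =ᶠ[nhds u] fun u => ((u : ℂ) ^ m)⁻¹ * χ (-1 / u) := by
      filter_upwards [isOpen_ne.mem_nhds hu] with v hv using hχφ v hv
    rw [heq.deriv_eq]
    refine hprod.deriv.trans ?_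
    simp only [Function.comp, Complex.real_smul]
    push_cast
    rcases m with _ | m
    · simp
      field_simp
    · simp only [Nat.add_sub_cancel]
      field_simp
      ring

theorem SmoothDecay.iteratedDeriv {m : ℕ} {φ : ℝ → ℂ} (h : SmoothDecay m φ) (n : ℕ) :
    SmoothDecay (m + n) (iteratedDeriv n φ) := by
  induction n with
  | zero => simpa using h
  | succ n ih =>
    rw [iteratedDeriv_succ]
    exact ih.deriv

theorem SmoothDecay.integrable_pow_mul {m : ℕ} {φ : ℝ → ℂ} (h : SmoothDecay m φ) {j : ℕ}
    (hj : j + 2 ≤ m) : Integrable (fun x : ℝ => ‖x‖ ^ j * ‖φ x‖) := by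
  obtain ⟨hφ, χ, hχ, hχφ⟩ := h
  obtain ⟨A, hA⟩ := (isCompact_Icc (a := (-1 : ℝ)) (b := 1)).exists_bound_of_continuousOn
    hφ.continuous.continuousOn
  obtain ⟨B, hB⟩ := (isCompact_Icc (a := (-1 : ℝ)) (b := 1)).exists_bound_of_continuousOn
    hχ.continuous.continuousOn
  have hA0 : 0 ≤ A := (norm_nonneg _).trans (hA 0 (by simp))
  have hB0 : 0 ≤ B := (norm_nonneg _).trans (hB 0 (by simp))
  refine (integrable_inv_one_add_sq.const_mul (2 * (A + B))).mono'
    ((continuous_norm.pow j).mul hφ.continuous.norm).aestronglyMeasurable (ae_of_all _ fun x => ?_)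
  rw [Real.norm_of_nonneg (by positivity), ← div_eq_mul_inv, le_div_iff₀ (by positivity),
    Real.norm_eq_abs]
  rcases le_total |x| 1 with hx | hx
  · have h1 : |x| ^ j ≤ 1 := pow_le_one₀ (abs_nonneg _) hx
    have h2 : 1 + x ^ 2 ≤ 2 := by nlinarith [sq_abs x, abs_nonneg x]
    calc |x| ^ j * ‖φ x‖ * (1 + x ^ 2) ≤ 1 * A * 2 := by
          gcongr
          exact hA x (abs_le.1 hx)
      _ ≤ 2 * (A + B) := by linarith
  · have hx0 : x ≠ 0 := by
      rintro rfl
      norm_num at hx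
    have hpos : 0 < |x| := abs_pos.2 hx0
    have hχB : ‖χ (-1 / x)‖ ≤ B := by
      refine hB _ (abs_le.1 ?_)
      rw [abs_div, abs_neg, abs_one]
      exact (div_le_one hpos).2 hx
    have h2 : 1 + x ^ 2 ≤ 2 * |x| ^ 2 := by nlinarith [sq_abs x]
    have h3 : |x| ^ j * |x| ^ 2 ≤ |x| ^ m := by
      rw [← pow_add]
      exact pow_le_pow_right₀ hx hj
    rw [hχφ x hx0, norm_mul, norm_inv, norm_pow, Complex.norm_real, Real.norm_eq_abs]
    calc |x| ^ j * ((|x| ^ m)⁻¹ * ‖χ (-1 / x)‖) * (1 + x ^ 2)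
        ≤ |x| ^ j * ((|x| ^ m)⁻¹ * B) * (2 * |x| ^ 2) := by gcongr
      _ = 2 * B * ((|x| ^ j * |x| ^ 2) / |x| ^ m) := by ring
      _ ≤ 2 * B * 1 := by
          gcongr
          exact (div_le_one (by positivity)).2 h3
      _ ≤ 2 * (A + B) := by linarith

theorem SmoothDecay.integrable {m : ℕ} {φ : ℝ → ℂ} (h : SmoothDecay m φ) (hm : 2 ≤ m) :
    Integrable φ := by
  refine (integrable_norm_iff h.1.continuous.aestronglyMeasurable).1 ?_
  simpa using h.integrable_pow_mul (j := 0) (by simpa using hm)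

open FourierTransform in
/-- The Fourier transform of `φ` is smooth away from `0`: up to the factor `y ^ n` it is the
Fourier transform of the `n`-th derivative, which decays fast enough to be `n` times
differentiable. -/
theorem SmoothDecay.contDiffAt_fourier {m : ℕ} {φ : ℝ → ℂ} (h : SmoothDecay m φ) (hm : 2 ≤ m)
    {y : ℝ} (hy : y ≠ 0) : ContDiffAt ℝ (⊤ : ℕ∞) (𝓕 φ) y := by
  refine contDiffAt_infty.2 fun n => ?_
  have hsmooth : ContDiff ℝ (n : ℕ∞) (𝓕 (_root_.iteratedDeriv n φ)) := by
    refine Real.contDiff_fourier fun k hk => (h.iteratedDeriv n).integrable_pow_mul ?_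
    have : k ≤ n := by exact_mod_cast hk
    omega
  have hfour : 𝓕 (_root_.iteratedDeriv n φ) =
      fun x : ℝ => (2 * Real.pi * Complex.I * x) ^ n • 𝓕 φ x :=
    Real.fourier_iteratedDeriv (N := (⊤ : ℕ∞)) h.1
      (fun k _ => (h.iteratedDeriv k).integrable (by omega)) le_top
  have hfac : ContDiff ℝ n (fun x : ℝ => (2 * Real.pi * Complex.I * (x : ℂ)) ^ n) :=
    (contDiff_const.mul Complex.ofRealCLM.contDiff).pow n
  have hne : ∀ x : ℝ, x ≠ 0 → (2 * Real.pi * Complex.I * (x : ℂ)) ^ n ≠ 0 := fun x hx => by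
    have : (x : ℂ) ≠ 0 := by exact_mod_cast hx
    simp [Real.pi_ne_zero, this]
  refine ((hfac.contDiffAt.inv (hne y hy)).mul (hsmooth.contDiffAt (x := y))).congr_of_eventuallyEq
    ?_
  filter_upwards [isOpen_ne.mem_nhds hy] with x hx
  rw [hfour]
  exact (inv_mul_cancel_left₀ (hne x hx) _).symm

open FourierTransform in
theorem fourierHat_eq_fourier (φ : ℝ → ℂ) (y : ℝ) :
    fourierHat φ y =
      (((2 * Real.pi) ^ (-(1 : ℝ) / 2) : ℝ) : ℂ) * 𝓕 φ (y / (2 * Real.pi)) := by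
  rw [fourierHat, Real.fourier_real_eq_integral_exp_smul]
  congr 2
  ext x
  rw [smul_eq_mul, mul_comm]
  congr 2
  push_cast
  have : (Real.pi : ℂ) ≠ 0 := by exact_mod_cast Real.pi_ne_zero
  field_simp

/-- every `f ∈ S̃_d` is smooth at every point `y ≠ 0`. -/
theorem Stilde_smooth_away_from_zero (d : ℕ) (hd : 0 < d) (f : ℝ → ℂ)
    (hf : MemStilde d f) : ∀ y : ℝ, y ≠ 0 → ContDiffAt ℝ (⊤ : ℕ∞) f y := by
  intro y hy
  obtain ⟨φ, hφ, hfφ⟩ := hf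
  have habs : ContDiffAt ℝ (⊤ : ℕ∞) (fun x : ℝ => |x| ^ ((1 - (d : ℝ)) / 2)) y :=
    (contDiffAt_abs hy).rpow_const_of_ne (abs_ne_zero.2 hy)
  have hhat : ContDiffAt ℝ (⊤ : ℕ∞) (fourierHat φ) y := by
    rw [funext (fourierHat_eq_fourier φ)]
    refine contDiffAt_const.mul ?_
    have hy' : y / (2 * Real.pi) ≠ 0 := div_ne_zero hy (by positivity)
    exact (hφ.smoothDecay.contDiffAt_fourier (by omega) hy').comp y
      (contDiffAt_id.div_const (2 * Real.pi))
  refine ((Complex.ofRealCLM.contDiff.contDiffAt.comp y habs).mul hhat).congr_of_eventuallyEq ?_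
  filter_upwards [isOpen_ne.mem_nhds hy] with x hx using hfφ x hx
end

section
/- Let d be a positive integer and let f : ℝ → ℂ be such that y ↦ |y|^{−(d+1)/2} f(y) extends to a smooth function on [0,∞) and extends to a smooth function on (−∞,0], and such that f and all its derivatives (on ℝ ∖ {0}) are rapidly decreasing at ±∞. Then the restriction of f to ℝ ∖ {0} belongs to S̃_d. -/
open MeasureTheory Set

open SchwartzMap Filter Topology

/-- Multiplication by the variable on Schwartz functions of a real variable. -/
noncomputable def mulVar : 𝓢(ℝ, ℂ) →L[ℂ] 𝓢(ℝ, ℂ) :=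
  SchwartzMap.smulLeftCLM ℂ (fun y : ℝ => (y : ℂ))

theorem mulVar_apply (G : 𝓢(ℝ, ℂ)) (y : ℝ) : mulVar G y = y * G y := by
  rw [mulVar, SchwartzMap.smulLeftCLM_apply_apply (by fun_prop), smul_eq_mul]

theorem mulVar_iterate_apply (n : ℕ) (G : 𝓢(ℝ, ℂ)) (y : ℝ) :
    (mulVar^[n] G) y = (y : ℂ) ^ n * G y := by
  induction n with
  | zero => simp
  | succ n ih => rw [Function.iterate_succ_apply', mulVar_apply, ih]; ring

theorem hasDerivAt_schwartz (G : 𝓢(ℝ, ℂ)) (y : ℝ) :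
    HasDerivAt G (SchwartzMap.derivCLM ℂ ℂ G y) y := by
  rw [SchwartzMap.derivCLM_apply]
  exact G.differentiableAt.hasDerivAt

theorem derivCLM_mulVar (G : 𝓢(ℝ, ℂ)) :
    SchwartzMap.derivCLM ℂ ℂ (mulVar G) = G + mulVar (SchwartzMap.derivCLM ℂ ℂ G) := by
  ext y
  have h1 := hasDerivAt_schwartz (mulVar G) y
  have h2 : HasDerivAt (mulVar G) (1 * G y + y * SchwartzMap.derivCLM ℂ ℂ G y) y := by
    have := (Complex.ofRealCLM.hasDerivAt (x := y)).mul (hasDerivAt_schwartz G y)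
    refine (this.congr_of_eventuallyEq (Eventually.of_forall fun z => ?_)).congr_deriv ?_
    · simp [mulVar_apply]
    · simp
  rw [h1.unique h2, add_apply, mulVar_apply, one_mul]

theorem derivCLM_mulVar_iterate_succ (n : ℕ) (G : 𝓢(ℝ, ℂ)) :
    SchwartzMap.derivCLM ℂ ℂ (mulVar^[n + 1] G) =
      mulVar^[n] (((n : ℂ) + 1) • G + mulVar (SchwartzMap.derivCLM ℂ ℂ G)) := by
  induction n with
  | zero => simp [derivCLM_mulVar]
  | succ n ih =>
    rw [Function.iterate_succ_apply', derivCLM_mulVar, ih]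
    ext y
    simp only [add_apply, smul_apply, mulVar_apply,
      mulVar_iterate_apply, smul_eq_mul]
    push_cast
    ring

/-- The Fourier integral `∫_0^∞ G(y) e^{ixy} dy` over the positive half-line. -/
noncomputable def halfFourier (G : 𝓢(ℝ, ℂ)) (x : ℝ) : ℂ :=
  ∫ y in Ioi (0 : ℝ), G y * Complex.exp (Complex.I * x * y)

theorem norm_exp_I_mul_mul (x y : ℝ) : ‖Complex.exp (Complex.I * x * y)‖ = 1 := by
  rw [mul_assoc, ← Complex.ofReal_mul, mul_comm, Complex.norm_exp_ofReal_mul_I]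

theorem integrable_mul_exp {F : ℝ → ℂ} (hF : Integrable F) (x : ℝ) :
    Integrable fun y : ℝ => F y * Complex.exp (Complex.I * x * y) := by
  refine hF.norm.mono' (hF.aestronglyMeasurable.mul
    (by fun_prop : Continuous fun y : ℝ => Complex.exp (Complex.I * x * y)).aestronglyMeasurable)
    (Eventually.of_forall fun y => ?_)
  rw [norm_mul, norm_exp_I_mul_mul, mul_one]

theorem norm_halfFourier_le (G : 𝓢(ℝ, ℂ)) (x : ℝ) :
    ‖halfFourier G x‖ ≤ ∫ y in Ioi (0 : ℝ), ‖G y‖ := by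
  refine (norm_integral_le_integral_norm _).trans_eq ?_
  simp only [norm_mul, norm_exp_I_mul_mul, mul_one]

theorem hasDerivAt_exp_I_mul_right (x y : ℝ) :
    HasDerivAt (fun y : ℝ => Complex.exp (Complex.I * x * y))
      (Complex.I * x * Complex.exp (Complex.I * x * y)) y := by
  have := ((Complex.ofRealCLM.hasDerivAt (x := y)).const_mul (Complex.I * x)).cexp
  simpa [mul_comm] using this

theorem hasDerivAt_exp_I_mul_left (x y : ℝ) :
    HasDerivAt (fun x : ℝ => Complex.exp (Complex.I * x * y))
      (Complex.I * y * Complex.exp (Complex.I * x * y)) x := by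
  have := hasDerivAt_exp_I_mul_right y x
  simpa only [mul_right_comm Complex.I] using this

theorem halfFourier_derivCLM (G : 𝓢(ℝ, ℂ)) (x : ℝ) :
    Complex.I * x * halfFourier G x = -G 0 - halfFourier (SchwartzMap.derivCLM ℂ ℂ G) x := by
  have hi := (integrable_mul_exp G.integrable x).integrableOn (s := Ioi (0 : ℝ))
  have hi' := (integrable_mul_exp (SchwartzMap.derivCLM ℂ ℂ G).integrable x).integrableOn
    (s := Ioi (0 : ℝ))
  have key := integral_Ioi_of_hasDerivAt_of_tendsto' (a := (0 : ℝ)) (m := (0 : ℂ))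
    (f := fun y : ℝ => G y * Complex.exp (Complex.I * x * y))
    (f' := fun y : ℝ => SchwartzMap.derivCLM ℂ ℂ G y * Complex.exp (Complex.I * x * y) +
      Complex.I * x * (G y * Complex.exp (Complex.I * x * y)))
    (fun y _ => ((hasDerivAt_schwartz G y).mul (hasDerivAt_exp_I_mul_right x y)).congr_deriv
      (by ring))
    (hi'.add (hi.const_mul _)) ?_
  · rw [integral_add hi' (hi.const_mul _), integral_const_mul] at key
    simp only [Complex.ofReal_zero, mul_zero, Complex.exp_zero, mul_one] at key
    rw [halfFourier, halfFourier]
    linear_combination key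
  · have h0 : Tendsto (fun y => ‖G y‖) atTop (𝓝 0) := by
      have := (zero_at_infty G).norm
      rw [norm_zero] at this
      exact this.mono_left atTop_le_cocompact
    refine squeeze_zero_norm (fun y => ?_) h0
    rw [norm_mul, norm_exp_I_mul_mul, mul_one]

theorem hasDerivAt_halfFourier (G : 𝓢(ℝ, ℂ)) (x : ℝ) :
    HasDerivAt (halfFourier G) (halfFourier (Complex.I • mulVar G) x) x := by
  refine (hasDerivAt_integral_of_dominated_loc_of_deriv_le (s := univ) univ_mem
    (μ := volume.restrict (Ioi (0 : ℝ)))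
    (F := fun (x : ℝ) (y : ℝ) => G y * Complex.exp (Complex.I * x * y))
    (F' := fun (x : ℝ) (y : ℝ) =>
      (Complex.I • mulVar G) y * Complex.exp (Complex.I * x * y))
    (bound := fun y => ‖(Complex.I • mulVar G) y‖)
    (Eventually.of_forall fun x =>
      (integrable_mul_exp G.integrable x).integrableOn.aestronglyMeasurable)
    (integrable_mul_exp G.integrable x).integrableOn
    (integrable_mul_exp (Complex.I • mulVar G).integrable x).integrableOn.aestronglyMeasurable
    (Eventually.of_forall fun y x _ => ?_)
    (Complex.I • mulVar G).integrable.norm.integrableOn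
    (Eventually.of_forall fun y x _ => ?_)).2
  · rw [norm_mul, norm_exp_I_mul_mul, mul_one]
  · refine ((hasDerivAt_exp_I_mul_left x y).const_mul (G y)).congr_deriv ?_
    rw [smul_apply, mulVar_apply, smul_eq_mul]
    ring

theorem contDiff_of_forall_hasDerivAt {ι : Type*} {u : ι → ℝ → ℂ}
    (h : ∀ i, ∃ (c : ℂ) (a : ℂ) (j : ι), ∀ x, HasDerivAt (u i) (c + a * u j x) x) (i : ι) :
    ContDiff ℝ (⊤ : ℕ∞) (u i) := by
  rw [contDiff_infty]
  intro n
  induction n generalizing i with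
  | zero =>
    obtain ⟨c, a, j, hj⟩ := h i
    exact contDiff_zero.2 (continuous_iff_continuousAt.2 fun x => (hj x).continuousAt)
  | succ n ih =>
    obtain ⟨c, a, j, hj⟩ := h i
    push_cast
    rw [contDiff_succ_iff_deriv]
    refine ⟨fun x => (hj x).differentiableAt, by simp, ?_⟩
    rw [show deriv (u i) = fun x => c + a * u j x from funext fun x => (hj x).deriv]
    exact contDiff_const.add (contDiff_const.mul (ih j))

theorem contDiff_halfFourier (G : 𝓢(ℝ, ℂ)) : ContDiff ℝ (⊤ : ℕ∞) (halfFourier G) :=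
  contDiff_of_forall_hasDerivAt (u := halfFourier)
    (fun G => ⟨0, 1, Complex.I • mulVar G, fun x => by
      simpa using hasDerivAt_halfFourier G x⟩) G

/-- The half-line Fourier integral in the coordinate `-1/x` at infinity. -/
noncomputable def halfFourierInv (G : 𝓢(ℝ, ℂ)) (x : ℝ) : ℂ :=
  if x = 0 then 0 else halfFourier G (-1 / x)

theorem halfFourierInv_eq (G : 𝓢(ℝ, ℂ)) (x : ℝ) :
    halfFourierInv G x =
      -Complex.I * x * (G 0 + halfFourierInv (SchwartzMap.derivCLM ℂ ℂ G) x) := by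
  by_cases hx : x = 0
  · simp [halfFourierInv, hx]
  · have h := halfFourier_derivCLM G (-1 / x)
    have hx' : (x : ℂ) ≠ 0 := by exact_mod_cast hx
    simp only [halfFourierInv, hx, if_false]
    generalize halfFourier (SchwartzMap.derivCLM ℂ ℂ G) (-1 / x) = b at h ⊢
    generalize halfFourier G (-1 / x) = a at h ⊢
    push_cast at h
    field_simp at h
    linear_combination Complex.I * h + a * Complex.I_sq

theorem tendsto_halfFourierInv_zero (G : 𝓢(ℝ, ℂ)) :
    Tendsto (halfFourierInv G) (𝓝 0) (𝓝 0) := by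
  set D := SchwartzMap.derivCLM ℂ ℂ G
  have hb : ∀ x, ‖halfFourierInv D x‖ ≤ ∫ y in Ioi (0 : ℝ), ‖D y‖ := fun x => by
    unfold halfFourierInv
    split_ifs
    · rw [norm_zero]; positivity
    · exact norm_halfFourier_le _ _
  have h1 : Tendsto (fun x : ℝ => |x| * (‖G 0‖ + ∫ y in Ioi (0 : ℝ), ‖D y‖)) (𝓝 0) (𝓝 0) := by
    have : Continuous fun x : ℝ => |x| * (‖G 0‖ + ∫ y in Ioi (0 : ℝ), ‖D y‖) := by fun_prop
    simpa using this.tendsto 0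
  refine squeeze_zero_norm (fun x => ?_) h1
  rw [halfFourierInv_eq, norm_mul]
  simp only [norm_mul, norm_neg, Complex.norm_I, one_mul, Complex.norm_real, Real.norm_eq_abs]
  gcongr
  exact (norm_add_le _ _).trans (by gcongr; exact hb x)

theorem hasDerivAt_halfFourierInv (G : 𝓢(ℝ, ℂ)) (x : ℝ) :
    HasDerivAt (halfFourierInv G) (-Complex.I * G 0 + (-1) * halfFourierInv
      (SchwartzMap.derivCLM ℂ ℂ (SchwartzMap.derivCLM ℂ ℂ (Complex.I • mulVar G))) x) x := by
  set D := SchwartzMap.derivCLM ℂ ℂ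
  by_cases hx : x = 0
  · subst hx
    rw [hasDerivAt_iff_tendsto_slope]
    have h := ((tendsto_halfFourierInv_zero (D G)).const_add (G 0)).const_mul (-Complex.I)
    have h0 : halfFourierInv (D (D (Complex.I • mulVar G))) 0 = 0 := if_pos rfl
    rw [h0, mul_zero, add_zero]
    rw [add_zero] at h
    refine (h.mono_left nhdsWithin_le_nhds).congr' ?_
    filter_upwards [self_mem_nhdsWithin] with z hz
    have hz' : (z : ℂ) ≠ 0 := by exact_mod_cast hz
    have hz0 : halfFourierInv G 0 = 0 := if_pos rfl
    rw [slope_def_module, hz0, halfFourierInv_eq G z]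
    simp only [sub_zero, Complex.real_smul, Complex.ofReal_inv]
    field_simp
    rfl
  · have hx' : (x : ℂ) ≠ 0 := by exact_mod_cast hx
    have hinv : HasDerivAt (fun z : ℝ => -1 / z) (1 / x ^ 2) x := by
      have := (hasDerivAt_inv hx).const_mul (-1)
      simpa [div_eq_mul_inv] using this
    have h := (hasDerivAt_halfFourier G (-1 / x)).scomp x hinv
    have he : halfFourierInv G =ᶠ[𝓝 x] (halfFourier G) ∘ fun z : ℝ => -1 / z := by
      filter_upwards [isOpen_ne.mem_nhds hx] with z hz
      exact if_neg hz
    refine (h.congr_of_eventuallyEq he).congr_deriv ?_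
    have e1 : halfFourier (Complex.I • mulVar G) (-1 / x) =
      halfFourierInv (Complex.I • mulVar G) x := (if_neg hx).symm
    have hD0 : D (Complex.I • mulVar G) 0 = Complex.I * G 0 := by
      simp only [D, map_smul, derivCLM_mulVar, smul_apply, add_apply,
        mulVar_apply, smul_eq_mul, Complex.ofReal_zero, zero_mul, add_zero]
    rw [e1, halfFourierInv_eq, halfFourierInv_eq (SchwartzMap.derivCLM ℂ ℂ _),
      show SchwartzMap.derivCLM ℂ ℂ (Complex.I • mulVar G) 0 = _ from hD0,
      smul_apply, mulVar_apply, Complex.real_smul]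
    push_cast
    simp only [zero_mul, smul_zero, zero_add]
    field_simp
    linear_combination (Complex.I * G 0 + halfFourierInv (D (D (Complex.I • mulVar G))) x) *
      Complex.I_sq

theorem contDiff_halfFourierInv (G : 𝓢(ℝ, ℂ)) : ContDiff ℝ (⊤ : ℕ∞) (halfFourierInv G) :=
  contDiff_of_forall_hasDerivAt (u := halfFourierInv)
    (fun G => ⟨_, _, _, hasDerivAt_halfFourierInv G⟩) G

theorem exists_contDiff_inv_pow_mul_halfFourier (n : ℕ) (G : 𝓢(ℝ, ℂ)) :
    ∃ ψ : ℝ → ℂ, ContDiff ℝ (⊤ : ℕ∞) ψ ∧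
      ∀ x : ℝ, x ≠ 0 → ψ x = ((x : ℂ) ^ (n + 1))⁻¹ * halfFourier (mulVar^[n] G) (-1 / x) := by
  have step : ∀ (H : 𝓢(ℝ, ℂ)) (x : ℝ), x ≠ 0 → halfFourier H (-1 / x) =
      -Complex.I * x * (H 0 + halfFourierInv (SchwartzMap.derivCLM ℂ ℂ H) x) := fun H x hx => by
    rw [← halfFourierInv_eq, halfFourierInv, if_neg hx]
  induction n generalizing G with
  | zero =>
    refine ⟨fun x => -Complex.I * (G 0 + halfFourierInv (SchwartzMap.derivCLM ℂ ℂ G) x),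
      contDiff_const.mul (contDiff_const.add (contDiff_halfFourierInv _)), fun x hx => ?_⟩
    have hx' : (x : ℂ) ≠ 0 := by exact_mod_cast hx
    rw [Function.iterate_zero_apply, step G x hx, zero_add, pow_one]
    field_simp
  | succ n ih =>
    obtain ⟨ψ, hψ, h⟩ := ih (((n : ℂ) + 1) • G + mulVar (SchwartzMap.derivCLM ℂ ℂ G))
    refine ⟨fun x => -Complex.I * ψ x, contDiff_const.mul hψ, fun x hx => ?_⟩
    have hx' : (x : ℂ) ≠ 0 := by exact_mod_cast hx
    simp only [h x hx]
    rw [step (mulVar^[n + 1] G) x hx, derivCLM_mulVar_iterate_succ, mulVar_iterate_apply, halfFourierInv,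
      if_neg hx]
    simp only [Complex.ofReal_zero, ne_eq, Nat.add_eq_zero_iff, one_ne_zero, and_false,
      not_false_eq_true, zero_pow, zero_mul, zero_add]
    field_simp
    ring

theorem exists_iteratedDeriv_rpow (r : ℝ) (k : ℕ) : ∃ c : ℝ, ∀ x : ℝ, 0 < x →
    iteratedDeriv k (fun y : ℝ => ((y ^ r : ℝ) : ℂ)) x = ((c * x ^ (r - k) : ℝ) : ℂ) := by
  induction k with
  | zero => exact ⟨1, fun x _ => by simp⟩
  | succ k ih =>
    obtain ⟨c, hc⟩ := ih
    refine ⟨c * (r - k), fun x hx => ?_⟩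
    have he : iteratedDeriv k (fun y : ℝ => ((y ^ r : ℝ) : ℂ)) =ᶠ[𝓝 x]
        fun y => ((c * y ^ (r - k) : ℝ) : ℂ) := by
      filter_upwards [lt_mem_nhds hx] with y hy using hc y hy
    rw [iteratedDeriv_succ, he.deriv_eq]
    have h := (((Real.hasDerivAt_rpow_const (p := r - k) (Or.inl hx.ne')).const_mul c)).ofReal_comp
    rw [h.deriv]
    push_cast
    rw [show r - (k : ℝ) - 1 = r - (k + 1) by ring]
    ring

theorem contDiffAt_ofReal_rpow (r : ℝ) {x : ℝ} (hx : 0 < x) (n : WithTop ℕ∞) :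
    ContDiffAt ℝ n (fun y : ℝ => ((y ^ r : ℝ) : ℂ)) x :=
  Complex.ofRealCLM.contDiff.contDiffAt.comp x (Real.contDiffAt_rpow_const_of_ne hx.ne')

theorem exists_bound_iteratedDeriv_rpow_mul {r : ℝ} {f : ℝ → ℂ}
    (hf : ∀ x : ℝ, 0 < x → ContDiffAt ℝ (⊤ : ℕ∞) f x)
    (hdecay : ∀ m n : ℕ, ∃ C : ℝ, ∀ y : ℝ, 1 ≤ y → y ^ m * ‖iteratedDeriv n f y‖ ≤ C) (m n : ℕ) :
    ∃ C : ℝ, ∀ y : ℝ, 1 ≤ y →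
      y ^ m * ‖iteratedDeriv n (fun y : ℝ => ((y ^ r : ℝ) : ℂ) * f y) y‖ ≤ C := by
  obtain ⟨N, hN⟩ := exists_nat_ge r
  choose c hc using exists_iteratedDeriv_rpow r
  choose C hC using hdecay
  refine ⟨∑ i ∈ Finset.range (n + 1), n.choose i * |c i| * C (m + N) (n - i), fun y hy => ?_⟩
  have hy0 : 0 < y := by linarith
  rw [iteratedDeriv_fun_mul (contDiffAt_ofReal_rpow r hy0 n)
    ((hf y hy0).of_le (by exact_mod_cast le_top))]
  refine (mul_le_mul_of_nonneg_left (norm_sum_le _ _) (by positivity)).trans ?_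
  rw [Finset.mul_sum]
  refine Finset.sum_le_sum fun i _ => ?_
  rw [norm_mul, norm_mul, hc i y hy0, Complex.norm_real, norm_mul, Complex.norm_natCast,
    Real.norm_eq_abs, Real.norm_of_nonneg (by positivity : 0 ≤ y ^ (r - i))]
  have h1 : y ^ (r - i) ≤ y ^ N := by
    rw [← Real.rpow_natCast]
    exact Real.rpow_le_rpow_of_exponent_le hy (by
      have : (0 : ℝ) ≤ i := by positivity
      linarith)
  calc y ^ m * (n.choose i * (|c i| * y ^ (r - i)) * ‖iteratedDeriv (n - i) f y‖)
      ≤ y ^ m * (n.choose i * (|c i| * y ^ N) * ‖iteratedDeriv (n - i) f y‖) := by gcongr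
    _ = n.choose i * |c i| * (y ^ (m + N) * ‖iteratedDeriv (n - i) f y‖) := by ring
    _ ≤ _ := by gcongr; exact hC _ _ y hy

theorem exists_schwartz_eq_of_nonneg {g : ℝ → ℂ} (hg : ContDiff ℝ (⊤ : ℕ∞) g)
    (hdecay : ∀ m n : ℕ, ∃ C : ℝ, ∀ y : ℝ, 1 < y → y ^ m * ‖iteratedDeriv n g y‖ ≤ C) :
    ∃ G : 𝓢(ℝ, ℂ), ∀ y : ℝ, 0 ≤ y → G y = g y := by
  set G : ℝ → ℂ := fun y => (Real.smoothTransition (y + 1) : ℂ) * g y with hGdef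
  have hG : ContDiff ℝ (⊤ : ℕ∞) G :=
    (Complex.ofRealCLM.contDiff.comp
      (Real.smoothTransition.contDiff.comp (contDiff_id.add contDiff_const))).mul hg
  have hright : ∀ y : ℝ, 0 ≤ y → G y = g y := fun y hy => by
    simp [hGdef, Real.smoothTransition.one_of_one_le (by linarith : 1 ≤ y + 1)]
  refine ⟨⟨G, hG, fun k n => ?_⟩, hright⟩
  obtain ⟨C, hC⟩ := hdecay k n
  have hcont : Continuous fun y : ℝ => |y| ^ k * ‖iteratedDeriv n G y‖ := by
    have := hG.continuous_iteratedDeriv n (by exact_mod_cast le_top)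
    fun_prop
  obtain ⟨B, hB⟩ := (isCompact_Icc (a := (-1 : ℝ)) (b := 1)).bddAbove_image hcont.continuousOn
  refine ⟨max (max C B) 0, fun y => ?_⟩
  rw [norm_iteratedFDeriv_eq_norm_iteratedDeriv, Real.norm_eq_abs]
  rcases lt_or_ge y (-1) with h | h
  · have he : G =ᶠ[𝓝 y] fun _ => 0 := by
      filter_upwards [gt_mem_nhds h] with z hz
      simp [hGdef, Real.smoothTransition.zero_of_nonpos (by linarith : z + 1 ≤ 0)]
    rw [he.iteratedDeriv_eq]
    simp
  · rcases le_or_gt y 1 with h1 | h1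
    · exact (hB ⟨y, ⟨h, h1⟩, rfl⟩).trans ((le_max_right _ _).trans (le_max_left _ _))
    · have he : G =ᶠ[𝓝 y] g := by
        filter_upwards [lt_mem_nhds (by linarith : 0 < y)] with z hz using hright z hz.le
      rw [he.iteratedDeriv_eq, abs_of_pos (by linarith)]
      exact (hC y h1).trans ((le_max_left _ _).trans (le_max_left _ _))

theorem exists_schwartz_eq_rpow_mul {r : ℝ} {f g : ℝ → ℂ} (hg : ContDiff ℝ (⊤ : ℕ∞) g)
    (hfg : ∀ y : ℝ, 0 < y → g y = ((y ^ r : ℝ) : ℂ) * f y)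
    (hdecay : ∀ m n : ℕ, ∃ C : ℝ, ∀ y : ℝ, 1 ≤ y → y ^ m * ‖iteratedDeriv n f y‖ ≤ C) :
    ∃ G : 𝓢(ℝ, ℂ), ∀ y : ℝ, 0 < y → G y = ((y ^ r : ℝ) : ℂ) * f y := by
  have hf : ∀ x : ℝ, 0 < x → ContDiffAt ℝ (⊤ : ℕ∞) f x := fun x hx => by
    refine ((contDiffAt_ofReal_rpow (-r) hx _).mul hg.contDiffAt).congr_of_eventuallyEq ?_
    filter_upwards [lt_mem_nhds hx] with y hy
    rw [hfg y hy, ← mul_assoc, ← Complex.ofReal_mul, ← Real.rpow_add hy]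
    simp
  obtain ⟨G, hG⟩ := exists_schwartz_eq_of_nonneg hg fun m n => by
    obtain ⟨C, hC⟩ := exists_bound_iteratedDeriv_rpow_mul (r := r) hf hdecay m n
    refine ⟨C, fun y hy => ?_⟩
    have he : g =ᶠ[𝓝 y] fun y : ℝ => ((y ^ r : ℝ) : ℂ) * f y := by
      filter_upwards [lt_mem_nhds (by linarith : 0 < y)] with z hz using hfg z hz
    rw [he.iteratedDeriv_eq]
    exact hC y hy.le
  exact ⟨G, fun y hy => (hG y hy.le).trans (hfg y hy)⟩

theorem MemI.integrable {d : ℕ} (hd : 0 < d) {φ : ℝ → ℂ} (hφ : MemI d φ) : Integrable φ := by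
  obtain ⟨hs, ψ, hψ, h⟩ := hφ
  obtain ⟨A, hA⟩ := (isCompact_Icc (a := (-1 : ℝ)) (b := 1)).bddAbove_image
    hψ.continuous.norm.continuousOn
  obtain ⟨B, hB⟩ := (isCompact_Icc (a := (-1 : ℝ)) (b := 1)).bddAbove_image
    hs.continuous.norm.continuousOn
  refine (integrable_inv_one_add_sq.const_mul (2 * max A B)).mono'
    hs.continuous.aestronglyMeasurable (Eventually.of_forall fun x => ?_)
  have hB0 : 0 ≤ max A B := (norm_nonneg _).trans
    ((hB ⟨0, ⟨by norm_num, by norm_num⟩, rfl⟩).trans (le_max_right A B))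
  rw [← div_eq_mul_inv, le_div_iff₀ (by positivity)]
  rcases le_or_gt |x| 1 with hx | hx
  · have h1 : ‖φ x‖ ≤ max A B := (hB ⟨x, abs_le.1 hx, rfl⟩).trans (le_max_right _ _)
    have h2 : x ^ 2 ≤ 1 := (sq_le_one_iff_abs_le_one x).2 hx
    calc ‖φ x‖ * (1 + x ^ 2) ≤ max A B * (1 + 1) := by gcongr
      _ = _ := by ring
  · have hx0 : x ≠ 0 := by rintro rfl; norm_num at hx
    have hx1 : -1 / x ≠ 0 := div_ne_zero (by norm_num) hx0
    have habs : |-1 / x| ≤ 1 := by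
      rw [abs_div, abs_neg, abs_one]
      exact (div_le_one (by linarith)).2 hx.le
    have h1 : ‖ψ (-1 / x)‖ ≤ max A B :=
      (hA ⟨_, abs_le.1 habs, rfl⟩).trans (le_max_left _ _)
    have h2 : |x| ^ (d + 1) * ‖φ x‖ = ‖ψ (-1 / x)‖ := by
      rw [h _ hx1, show -1 / (-1 / x) = x by field_simp]
      simp
    have h3 : 1 + x ^ 2 ≤ 2 * |x| ^ (d + 1) := by
      have : |x| ^ 2 ≤ |x| ^ (d + 1) := pow_le_pow_right₀ hx.le (by omega)
      rw [sq_abs] at this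
      have : 1 ≤ x ^ 2 := (one_le_sq_iff_one_le_abs x).2 hx.le
      linarith
    calc ‖φ x‖ * (1 + x ^ 2) ≤ ‖φ x‖ * (2 * |x| ^ (d + 1)) := by gcongr
      _ = 2 * (|x| ^ (d + 1) * ‖φ x‖) := by ring
      _ ≤ _ := by rw [h2]; gcongr

theorem memI_halfFourier_add (d : ℕ) (c : ℂ) (G H : 𝓢(ℝ, ℂ)) :
    MemI d fun x => c * (halfFourier (mulVar^[d] G) x + halfFourier (mulVar^[d] H) (-x)) := by
  obtain ⟨ψ, hψ, h⟩ := exists_contDiff_inv_pow_mul_halfFourier d G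
  obtain ⟨χ, hχ, h'⟩ := exists_contDiff_inv_pow_mul_halfFourier d H
  refine ⟨contDiff_const.mul ((contDiff_halfFourier _).add
    ((contDiff_halfFourier _).comp contDiff_neg)),
    fun x => c * (ψ x + (-1) ^ (d + 1) * χ (-x)),
    contDiff_const.mul (hψ.add (contDiff_const.mul (hχ.comp contDiff_neg))), fun x hx => ?_⟩
  have hx' : (x : ℂ) ≠ 0 := by exact_mod_cast hx
  have e : ((-1 : ℂ)) ^ (d + 1) * (((-x : ℝ) : ℂ) ^ (d + 1))⁻¹ = ((x : ℂ) ^ (d + 1))⁻¹ := by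
    rw [← inv_pow, ← mul_pow, ← inv_pow]
    congr 1
    push_cast
    field_simp
  simp only [h x hx, h' (-x) (neg_ne_zero.2 hx)]
  rw [← mul_assoc _ _ (halfFourier _ _), e, show -1 / -x = -(-1 / x) by field_simp]
  ring

open FourierTransform in
theorem fourierHat_eq_of_eq_integral {F φ : ℝ → ℂ} (hF : Continuous F) (hFi : Integrable F)
    (hφ : ∀ x : ℝ, φ x = (((2 * Real.pi) ^ (-(1 : ℝ) / 2) : ℝ) : ℂ) *
      ∫ y : ℝ, F y * Complex.exp (Complex.I * x * y)) (hφi : Integrable φ) (y : ℝ) :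
    fourierHat φ y = F y := by
  have hpi : (0 : ℝ) < 2 * Real.pi := by positivity
  set c : ℝ := (2 * Real.pi) ^ (-(1 : ℝ) / 2) with hc
  have hc0 : c ≠ 0 := (Real.rpow_pos_of_pos hpi _).ne'
  have hcc : c * c = (2 * Real.pi)⁻¹ := by
    rw [hc, ← Real.rpow_add hpi, ← Real.rpow_neg_one]
    norm_num
  have h1 : ∀ w : ℝ, φ (2 * Real.pi * w) = c * 𝓕⁻ F w := fun w => by
    rw [hφ, Real.fourierInv_eq']
    congr 2
    ext v
    rw [smul_eq_mul, mul_comm]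
    congr 2
    simp
    ring
  have hinv : Integrable (𝓕⁻ F) := by
    have := (hφi.comp_mul_left' hpi.ne').const_mul ((c : ℂ)⁻¹)
    refine this.congr (Eventually.of_forall fun w => ?_)
    have hcC : (c : ℂ) ≠ 0 := by exact_mod_cast hc0
    simp only [h1]
    field_simp
  have hFF : Integrable (𝓕 F) := by
    have := hinv.comp_neg
    refine this.congr (Eventually.of_forall fun w => ?_)
    simp [Real.fourierInv_eq_fourier_neg]
  rw [← congrFun (hF.fourier_fourierInv_eq hFi hFF) y, Real.fourier_real_eq_integral_exp_smul,
    fourierHat, ← hc]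
  have h2 := Measure.integral_comp_mul_left
    (fun x : ℝ => φ x * Complex.exp (-(Complex.I * x * y))) (2 * Real.pi)
  rw [abs_of_pos (inv_pos.2 hpi), ← hcc] at h2
  have h3 : ∫ w : ℝ, φ (2 * Real.pi * w) *
      Complex.exp (-(Complex.I * ((2 * Real.pi * w : ℝ) : ℂ) * y)) =
      c * ∫ v : ℝ, Complex.exp (((-2 * Real.pi * v * y : ℝ) : ℂ) * Complex.I) • 𝓕⁻ F v := by
    rw [← integral_const_mul]
    congr 1
    ext w
    rw [h1, smul_eq_mul]
    have : -(Complex.I * ((2 * Real.pi * w : ℝ) : ℂ) * y) =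
      ((-2 * Real.pi * w * y : ℝ) : ℂ) * Complex.I := by push_cast; ring
    rw [this]
    ring
  have hcC : (c : ℂ) ≠ 0 := by exact_mod_cast hc0
  rw [h3, Complex.real_smul] at h2
  push_cast at h2 ⊢
  refine mul_left_cancel₀ hcC ?_
  rw [h2]
  ring

/-- The function equal to `G` on the positive and to `y ↦ H (-y)` on the nonpositive half-line. -/
noncomputable def glue (G H : 𝓢(ℝ, ℂ)) (y : ℝ) : ℂ :=
  if y ≤ 0 then H (-y) else G y

theorem continuous_glue {G H : 𝓢(ℝ, ℂ)} (h : G 0 = H 0) : Continuous (glue G H) :=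
  Continuous.if_le (by fun_prop) (by fun_prop) continuous_id continuous_const
    (by rintro x rfl; simp [h])

theorem integrable_glue (G H : 𝓢(ℝ, ℂ)) : Integrable (glue G H) := by
  refine (Integrable.piecewise (s := Iic (0 : ℝ)) measurableSet_Iic
    H.integrable.comp_neg.integrableOn G.integrable.integrableOn).congr
    (Eventually.of_forall fun y => ?_)
  simp [Set.piecewise, glue]

theorem integral_glue_mul_exp (G H : 𝓢(ℝ, ℂ)) (x : ℝ) :
    ∫ y : ℝ, glue G H y * Complex.exp (Complex.I * x * y) =
      halfFourier G x + halfFourier H (-x) := by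
  have hi := integrable_mul_exp (integrable_glue G H) x
  rw [← intervalIntegral.integral_Iic_add_Ioi (b := 0) hi.integrableOn hi.integrableOn, add_comm]
  congr 1
  · refine setIntegral_congr_fun measurableSet_Ioi fun y hy => ?_
    simp [glue, not_le.2 (mem_Ioi.1 hy)]
  · have := integral_comp_neg_Iic (0 : ℝ)
      (fun y : ℝ => H y * Complex.exp (Complex.I * ((-x : ℝ) : ℂ) * y))
    rw [neg_zero] at this
    rw [halfFourier, ← this]
    refine setIntegral_congr_fun measurableSet_Iic fun y hy => ?_
    simp [glue, mem_Iic.1 hy]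

/-- if `y ↦ |y|^{-(d+1)/2} f(y)` extends to a smooth function on `[0,∞)`
and to a smooth function on `(-∞,0]`, and `f` and all its derivatives (away from `0`)
are rapidly decreasing at `±∞`, then `f` (as a function on `ℝ ∖ {0}`) lies in `S̃_d`. -/
theorem mem_Stilde_of_smooth_sides (d : ℕ) (hd : 0 < d) (f : ℝ → ℂ)
    (hright : ∃ g : ℝ → ℂ, ContDiff ℝ (⊤ : ℕ∞) g ∧
      ∀ y : ℝ, 0 < y → g y = ((|y| ^ (-((d : ℝ) + 1) / 2) : ℝ) : ℂ) * f y)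
    (hleft : ∃ g : ℝ → ℂ, ContDiff ℝ (⊤ : ℕ∞) g ∧
      ∀ y : ℝ, y < 0 → g y = ((|y| ^ (-((d : ℝ) + 1) / 2) : ℝ) : ℂ) * f y)
    (hdecay : ∀ m n : ℕ, ∃ C : ℝ, ∀ y : ℝ, 1 ≤ |y| → |y| ^ m * ‖iteratedDeriv n f y‖ ≤ C) :
    MemStilde d f := by
  set r : ℝ := -((d : ℝ) + 1) / 2 with hr
  obtain ⟨g, hg, hgf⟩ := hright
  obtain ⟨k, hk, hkf⟩ := hleft
  obtain ⟨G, hG⟩ := exists_schwartz_eq_rpow_mul (r := r) (f := f) hg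
    (fun y hy => by rw [hgf y hy, abs_of_pos hy])
    (fun m n => by
      obtain ⟨C, hC⟩ := hdecay m n
      refine ⟨C, fun y hy => ?_⟩
      have := hC y (hy.trans (le_abs_self y))
      rwa [abs_of_pos (by linarith)] at this)
  obtain ⟨H, hH⟩ := exists_schwartz_eq_rpow_mul (r := r) (f := fun y => f (-y))
    (g := fun y => k (-y)) (hk.comp contDiff_neg)
    (fun y hy => by rw [hkf (-y) (neg_neg_of_pos hy), abs_neg, abs_of_pos hy])
    (fun m n => by
      obtain ⟨C, hC⟩ := hdecay m n
      refine ⟨C, fun y hy => ?_⟩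
      have := hC (-y) (by rw [abs_neg]; exact hy.trans (le_abs_self y))
      rw [abs_neg, abs_of_pos (by linarith)] at this
      rw [iteratedDeriv_comp_neg, norm_smul]
      simpa using this)
  have hI := memI_halfFourier_add d (((2 * Real.pi) ^ (-(1 : ℝ) / 2) : ℝ) : ℂ) G H
  have hrpow : ∀ t : ℝ, 0 < t → t ^ ((1 - (d : ℝ)) / 2) * (t ^ d * t ^ r) = 1 := fun t ht => by
    rw [← Real.rpow_natCast, ← Real.rpow_add ht, ← Real.rpow_add ht, hr,
      show (1 - (d : ℝ)) / 2 + (d + -((d : ℝ) + 1) / 2) = 0 by ring, Real.rpow_zero]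
  refine ⟨_, hI, fun y hy => ?_⟩
  rw [Md, fourierHat_eq_of_eq_integral (F := glue (mulVar^[d] G) (mulVar^[d] H))
    (continuous_glue (by simp [mulVar_iterate_apply, hd.ne'])) (integrable_glue _ _)
    (fun x => by rw [integral_glue_mul_exp]) (hI.integrable hd)]
  rcases lt_or_gt_of_ne hy with h | h
  · have h' : 0 < -y := neg_pos.2 h
    have e := hrpow (-y) h'
    rw [glue, if_pos h.le, mulVar_iterate_apply, hH _ h', neg_neg, abs_of_neg h,
      ← Complex.ofReal_pow, ← mul_assoc, ← mul_assoc, ← Complex.ofReal_mul, ← Complex.ofReal_mul,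
      mul_assoc, e, Complex.ofReal_one, one_mul]
  · have e := hrpow y h
    rw [glue, if_neg h.not_ge, mulVar_iterate_apply, hG _ h, abs_of_pos h,
      ← Complex.ofReal_pow, ← mul_assoc, ← mul_assoc, ← Complex.ofReal_mul, ← Complex.ofReal_mul,
      mul_assoc, e, Complex.ofReal_one, one_mul]
end
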